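/- Let K be the number field defined by X³ + X² - 2X - 1 with ω a root. Then the unit group of the ring of integers of K is generated by -1, -ω² + 1 and ω + 1. -/

import Mathlib

open Polynomial in
theorem exists_algHom_of_minpoly_cubic {K L : Type*} [Field K] [NumberField K] [Field L]
    [Algebra ℚ L] {ω : K} (hmin : minpoly ℚ ω = X ^ 3 + X ^ 2 - 2 * X - 1)
    (hgen : IntermediateField.adjoin ℚ {ω} = ⊤) {y : L} (hy : y ^ 3 = 1 + 2 * y - y ^ 2) :
    ∃ f : K →ₐ[ℚ] L, f ω = y := by
  have hint : IsIntegral ℚ ω := Algebra.IsIntegral.isIntegral ω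
  have htop : Algebra.adjoin ℚ {ω} = ⊤ := by
    rw [← IntermediateField.adjoin_simple_toSubalgebra_of_isAlgebraic hint.isAlgebraic, hgen,
      IntermediateField.top_toSubalgebra]
  have hroot : aeval y (minpoly ℚ (PowerBasis.ofAdjoinEqTop hint htop).gen) = 0 := by
    rw [PowerBasis.ofAdjoinEqTop_gen, hmin]
    simp only [map_sub, map_add, map_mul, map_pow, aeval_X, map_one, map_ofNat]
    linear_combination hy
  refine ⟨(PowerBasis.ofAdjoinEqTop hint htop).lift y hroot, ?_⟩
  simpa using (PowerBasis.ofAdjoinEqTop hint htop).lift_gen y hroot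

theorem exists_quadratic_coords {K : Type*} [Field K] [NumberField K] {ω : K}
    (hω : ω ^ 3 = 1 + 2 * ω - ω ^ 2) (hgen : IntermediateField.adjoin ℚ {ω} = ⊤) (x : K) :
    ∃ a b c : ℚ, x = a + b * ω + c * ω ^ 2 := by
  have hint : IsIntegral ℚ ω := Algebra.IsIntegral.isIntegral ω
  have hx : x ∈ Algebra.adjoin ℚ {ω} := by
    rw [← IntermediateField.adjoin_simple_toSubalgebra_of_isAlgebraic hint.isAlgebraic, hgen]
    trivial
  induction hx using Algebra.adjoin_induction with
  | mem y hy =>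
    obtain rfl : y = ω := hy
    exact ⟨0, 1, 0, by simp⟩
  | algebraMap r => exact ⟨r, 0, 0, by simp⟩
  | add y z _ _ hy hz =>
    obtain ⟨a, b, c, rfl⟩ := hy
    obtain ⟨a', b', c', rfl⟩ := hz
    exact ⟨a + a', b + b', c + c', by push_cast; ring⟩
  | mul y z _ _ hy hz =>
    obtain ⟨a, b, c, rfl⟩ := hy
    obtain ⟨a', b', c', rfl⟩ := hz
    refine ⟨a * a' + (b * c' + c * b') - c * c', a * b' + b * a' + 2 * (b * c' + c * b') - c * c',
      a * c' + b * b' + c * a' - (b * c' + c * b') + 3 * (c * c'), ?_⟩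
    push_cast
    linear_combination ((b : K) * c' + c * b' + c * c' * (ω - 1)) * hω

theorem exists_int_of_isIntegral_ratCast {q : ℚ} {x : ℝ} (hx : IsIntegral ℤ x) (hq : x = q) :
    ∃ n : ℤ, x = n := by
  subst hq
  have h : IsIntegral ℤ q :=
    (isIntegral_algebraMap_iff (algebraMap ℚ ℝ).injective).1 (by simpa using hx)
  obtain ⟨n, rfl⟩ := IsIntegrallyClosed.isIntegral_iff.1 h
  exact ⟨n, by simp⟩

section Conjugates

variable {K : Type*} [Field K] [NumberField K] {ω : K} {f₁ f₂ f₃ : K →ₐ[ℚ] ℝ} {r : ℝ}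

theorem exists_int_sum_conjugates (hω : ω ^ 3 = 1 + 2 * ω - ω ^ 2)
    (hgen : IntermediateField.adjoin ℚ {ω} = ⊤) (hr : r ^ 3 = 1 + 2 * r - r ^ 2)
    (h₁ : f₁ ω = r) (h₂ : f₂ ω = r ^ 2 - 2) (h₃ : f₃ ω = 1 - r - r ^ 2)
    {x : K} (hx : IsIntegral ℤ x) : ∃ n : ℤ, f₁ x + f₂ x + f₃ x = n := by
  have hint : IsIntegral ℤ (f₁ x + f₂ x + f₃ x) :=
    ((hx.map (f₁.restrictScalars ℤ)).add (hx.map (f₂.restrictScalars ℤ))).add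
      (hx.map (f₃.restrictScalars ℤ))
  obtain ⟨a, b, c, rfl⟩ := exists_quadratic_coords hω hgen x
  refine exists_int_of_isIntegral_ratCast (q := 3 * a - b + 5 * c) hint ?_
  simp only [map_add, map_mul, map_pow, h₁, h₂, h₃, map_ratCast]
  push_cast
  linear_combination 2 * (c : ℝ) * r * hr

theorem exists_int_prod_conjugates (hω : ω ^ 3 = 1 + 2 * ω - ω ^ 2)
    (hgen : IntermediateField.adjoin ℚ {ω} = ⊤) (hr : r ^ 3 = 1 + 2 * r - r ^ 2)
    (h₁ : f₁ ω = r) (h₂ : f₂ ω = r ^ 2 - 2) (h₃ : f₃ ω = 1 - r - r ^ 2)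
    {x : K} (hx : IsIntegral ℤ x) : ∃ n : ℤ, f₁ x * f₂ x * f₃ x = n := by
  have hint : IsIntegral ℤ (f₁ x * f₂ x * f₃ x) :=
    ((hx.map (f₁.restrictScalars ℤ)).mul (hx.map (f₂.restrictScalars ℤ))).mul
      (hx.map (f₃.restrictScalars ℤ))
  obtain ⟨a, b, c, rfl⟩ := exists_quadratic_coords hω hgen x
  refine exists_int_of_isIntegral_ratCast
    (q := a * ((a + 2 * c) * (a - b + 3 * c) - (b - c) * (2 * b - c))
      - b * (c * (a - b + 3 * c) - (b - c) * (b - c))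
      + c * (c * (2 * b - c) - (a + 2 * c) * (b - c))) hint ?_
  have hr₂ : (r ^ 2 - 2) ^ 2 = 3 - r - r ^ 2 := by linear_combination (r - 1) * hr
  have hr₃ : (1 - r - r ^ 2) ^ 2 = 2 + r := by linear_combination (r + 1) * hr
  simp only [map_add, map_mul, map_pow, h₁, h₂, h₃, map_ratCast, hr₂, hr₃]
  push_cast
  grind

theorem prod_conjugates_sq_eq_one (hω : ω ^ 3 = 1 + 2 * ω - ω ^ 2)
    (hgen : IntermediateField.adjoin ℚ {ω} = ⊤) (hr : r ^ 3 = 1 + 2 * r - r ^ 2)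
    (h₁ : f₁ ω = r) (h₂ : f₂ ω = r ^ 2 - 2) (h₃ : f₃ ω = 1 - r - r ^ 2)
    (v : (NumberField.RingOfIntegers K)ˣ) :
    f₁ (v : K) ^ 2 * f₂ (v : K) ^ 2 * f₃ (v : K) ^ 2 = 1 := by
  obtain ⟨m, hm⟩ := exists_int_prod_conjugates hω hgen hr h₁ h₂ h₃
    (NumberField.RingOfIntegers.isIntegral_coe (v : NumberField.RingOfIntegers K))
  obtain ⟨n, hn⟩ := exists_int_prod_conjugates hω hgen hr h₁ h₂ h₃
    (NumberField.RingOfIntegers.isIntegral_coe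
      ((v⁻¹ : (NumberField.RingOfIntegers K)ˣ) : NumberField.RingOfIntegers K))
  have hv : (v : K) * ((v⁻¹ : (NumberField.RingOfIntegers K)ˣ) : K) = 1 := by
    rw [← map_mul, ← Units.val_mul, mul_inv_cancel, Units.val_one, map_one]
  have hmn : m * n = 1 := by
    have e₁ := congrArg f₁ hv
    have e₂ := congrArg f₂ hv
    have e₃ := congrArg f₃ hv
    rw [map_mul, map_one] at e₁ e₂ e₃
    have : (m : ℝ) * n = 1 := by
      rw [← hm, ← hn, mul_mul_mul_comm, mul_mul_mul_comm (f₁ _), e₁, e₂, e₃, mul_one, mul_one]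
    exact_mod_cast this
  have hm1 : (m : ℝ) ^ 2 = 1 := by
    rcases Int.eq_one_or_neg_one_of_mul_eq_one hmn with h | h <;> simp [h]
  rw [← hm1, ← hm]
  ring

end Conjugates

theorem add_pow_three_lt_of_max {a b c : ℝ} (ha : 0 < a) (hb : 0 < b) (hc : 0 < c)
    (hba : b ≤ a) (hca : c ≤ a) (h₁ : 0 ≤ 0.556 * c - 0.801 * a + 2.248 * b)
    (h₂ : 0 ≤ -0.356 * b + 4.05 * c - 0.691 * a)
    (h₃ : 0 ≤ -0.356 * a + 4.05 * b - 0.691 * c) :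
    (a + b + c) ^ 3 < 64 * (a * b * c) := by
  have hx : 0 ≤ a - b := by linarith
  have hy : 0 ≤ a - c := by linarith
  nlinarith [mul_nonneg (mul_nonneg hx hy) ha.le, mul_pos (mul_pos ha hb) hc,
    mul_nonneg (mul_nonneg h₁ h₂) ha.le, mul_nonneg (mul_nonneg h₁ h₂) hb.le,
    mul_nonneg (mul_nonneg h₁ h₂) hc.le, mul_nonneg (mul_nonneg h₁ hx) ha.le,
    mul_nonneg (mul_nonneg h₂ hy) ha.le, mul_nonneg (mul_nonneg h₁ hy) ha.le,
    mul_nonneg (mul_nonneg h₂ hx) ha.le]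

theorem add_pow_three_lt {a b c : ℝ} (ha : 0 < a) (hb : 0 < b) (hc : 0 < c)
    (h₁ : 0 ≤ 0.556 * a - 0.801 * b + 2.248 * c) (h₂ : 0 ≤ 0.556 * b - 0.801 * c + 2.248 * a)
    (h₃ : 0 ≤ 0.556 * c - 0.801 * a + 2.248 * b)
    (h₄ : 0 ≤ -0.356 * a + 4.05 * b - 0.691 * c) (h₅ : 0 ≤ -0.356 * b + 4.05 * c - 0.691 * a)
    (h₆ : 0 ≤ -0.356 * c + 4.05 * a - 0.691 * b) :
    (a + b + c) ^ 3 < 64 * (a * b * c) := by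
  rcases le_total b a with hba | hba <;> rcases le_total c a with hca | hca
  · exact add_pow_three_lt_of_max ha hb hc hba hca h₃ h₅ h₄
  · linarith [add_pow_three_lt_of_max hc ha hb hca (hba.trans hca) h₂ h₄ h₆]
  · linarith [add_pow_three_lt_of_max hb hc ha (hca.trans hba) hba h₁ h₆ h₅]
  · rcases le_total b c with hbc | hbc
    · linarith [add_pow_three_lt_of_max hc ha hb hca hbc h₂ h₄ h₆]
    · linarith [add_pow_three_lt_of_max hb hc ha hbc hba h₁ h₆ h₅]

theorem eq_one_of_sum_eq_three {a b c : ℝ} (ha : 0 < a) (hb : 0 < b) (hc : 0 < c)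
    (hprod : a * b * c = 1) (hsum : a + b + c = 3) : a = 1 := by
  obtain rfl : c = 3 - a - b := by linarith
  have h : a * (b - (3 - a - b)) ^ 2 + (a - 1) ^ 2 * (4 - a) = 0 := by
    linear_combination (-4) * hprod
  have h₁ : 0 ≤ a * (b - (3 - a - b)) ^ 2 := by positivity
  have h₂ : 0 < 4 - a := by linarith
  have h₃ : (a - 1) ^ 2 * (4 - a) = 0 := by
    have : 0 ≤ (a - 1) ^ 2 * (4 - a) := by positivity
    linarith
  have h₄ : a - 1 = 0 := by simpa [h₂.ne'] using h₃
  linarith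

theorem add_pow_three_lt_of_le_unit_twists {a b c r : ℝ} (ha : 0 < a) (hb : 0 < b) (hc : 0 < c)
    (hr : r ^ 3 = 1 + 2 * r - r ^ 2) (hr_lower : 1.2469 < r) (hr_upper : r < 1.247)
    (h₁ : a + b + c ≤ a * r ^ 2 + b * (r ^ 2 - 2) ^ 2 + c * (1 - r - r ^ 2) ^ 2)
    (h₂ : a + b + c ≤ a * (1 - r - r ^ 2) ^ 2 + b * r ^ 2 + c * (r ^ 2 - 2) ^ 2)
    (h₃ : a + b + c ≤ a * (r ^ 2 - 2) ^ 2 + b * (1 - r - r ^ 2) ^ 2 + c * r ^ 2)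
    (h₄ : a + b + c ≤ a * (2 - r - r ^ 2) ^ 2 + b * (1 + r) ^ 2 + c * (1 - r ^ 2) ^ 2)
    (h₅ : a + b + c ≤ a * (1 - r ^ 2) ^ 2 + b * (2 - r - r ^ 2) ^ 2 + c * (1 + r) ^ 2)
    (h₆ : a + b + c ≤ a * (1 + r) ^ 2 + b * (1 - r ^ 2) ^ 2 + c * (2 - r - r ^ 2) ^ 2) :
    (a + b + c) ^ 3 < 64 * (a * b * c) := by
  have hr₂ : (r ^ 2 - 2) ^ 2 = 3 - r - r ^ 2 := by linear_combination (r - 1) * hr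
  have hr₃ : (1 - r - r ^ 2) ^ 2 = 2 + r := by linear_combination (r + 1) * hr
  have hsq_upper : r ^ 2 ≤ 1.5551 := by nlinarith
  have hsq_lower : 1.5547 ≤ r ^ 2 := by nlinarith
  have le_twist {x y z A B C : ℝ} (h : a + b + c ≤ a * x + b * y + c * z)
      (hA : x ≤ A) (hB : y ≤ B) (hC : z ≤ C) :
      0 ≤ a * (A - 1) + b * (B - 1) + c * (C - 1) := by
    linarith [mul_le_mul_of_nonneg_left hA ha.le, mul_le_mul_of_nonneg_left hB hb.le,
      mul_le_mul_of_nonneg_left hC hc.le]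
  have q₁ : r ^ 2 ≤ 1.556 := by linarith
  have q₂ : (r ^ 2 - 2) ^ 2 ≤ 0.199 := by linarith
  have q₃ : (1 - r - r ^ 2) ^ 2 ≤ 3.248 := by linarith
  have q₄ : (1 + r) ^ 2 ≤ 5.05 := by linarith
  have q₅ : (1 - r ^ 2) ^ 2 ≤ 0.309 := by linarith
  have q₆ : (2 - r - r ^ 2) ^ 2 ≤ 0.644 := by linarith
  refine add_pow_three_lt ha hb hc ?_ ?_ ?_ ?_ ?_ ?_
  · linarith [le_twist h₁ q₁ q₂ q₃]
  · linarith [le_twist h₂ q₃ q₁ q₂]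
  · linarith [le_twist h₃ q₂ q₃ q₁]
  · linarith [le_twist h₄ q₆ q₄ q₅]
  · linarith [le_twist h₅ q₅ q₆ q₄]
  · linarith [le_twist h₆ q₄ q₅ q₆]

theorem mul_le_add_pow_three {a b c : ℝ} (ha : 0 ≤ a) (hb : 0 ≤ b) (hc : 0 ≤ c) :
    27 * (a * b * c) ≤ (a + b + c) ^ 3 := by
  nlinarith [mul_nonneg ha (sq_nonneg (b - c)), mul_nonneg hb (sq_nonneg (c - a)),
    mul_nonneg hc (sq_nonneg (a - b)), mul_nonneg (add_nonneg (add_nonneg ha hb) hc)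
      (add_nonneg (add_nonneg (sq_nonneg (a - b)) (sq_nonneg (b - c))) (sq_nonneg (c - a)))]

theorem exists_real_root_cubic :
    ∃ r : ℝ, r ^ 3 = 1 + 2 * r - r ^ 2 ∧ 1.2469 < r ∧ r < 1.247 := by
  have hcont : ContinuousOn (fun x : ℝ => x ^ 3 + x ^ 2 - 2 * x - 1) (Set.Icc 1.2469 1.247) := by
    fun_prop
  obtain ⟨r, hr, h⟩ := intermediate_value_Ioo (by norm_num) hcont
    (show (0 : ℝ) ∈ Set.Ioo _ _ by constructor <;> norm_num)
  exact ⟨r, by linarith [show r ^ 3 + r ^ 2 - 2 * r - 1 = 0 from h], hr.1, hr.2⟩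

open Polynomial in
theorem stmt_12 (K : Type*) [Field K] [NumberField K] (ω : K)
    (hmin : minpoly ℚ ω = X ^ 3 + X ^ 2 - 2 * X - 1)
    (hgen : IntermediateField.adjoin ℚ {ω} = ⊤)
    (u₁ u₂ u₃ : (NumberField.RingOfIntegers K)ˣ)
    (hu₁ : algebraMap (NumberField.RingOfIntegers K) K u₁ = -1)
    (hu₂ : algebraMap (NumberField.RingOfIntegers K) K u₂ = -ω ^ 2 + 1)
    (hu₃ : algebraMap (NumberField.RingOfIntegers K) K u₃ = ω + 1) :
    Subgroup.closure {u₁, u₂, u₃} = ⊤ := by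
  have hω : ω ^ 3 = 1 + 2 * ω - ω ^ 2 := by
    have h := minpoly.aeval ℚ ω
    rw [hmin] at h
    simp only [map_sub, map_add, map_mul, map_pow, aeval_X, map_one, map_ofNat] at h
    linear_combination h
  obtain ⟨r, hr, hr_lower, hr_upper⟩ := exists_real_root_cubic
  obtain ⟨f₁, h₁⟩ := exists_algHom_of_minpoly_cubic hmin hgen hr
  obtain ⟨f₂, h₂⟩ := exists_algHom_of_minpoly_cubic hmin hgen (y := r ^ 2 - 2) (by grind)
  obtain ⟨f₃, h₃⟩ := exists_algHom_of_minpoly_cubic hmin hgen (y := 1 - r - r ^ 2) (by grind)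
  set G := Subgroup.closure {u₁, u₂, u₃}
  have hG₁ : u₁ ∈ G := Subgroup.subset_closure (by simp)
  have hG₂ : u₂ ∈ G := Subgroup.subset_closure (by simp)
  have hG₃ : u₃ ∈ G := Subgroup.subset_closure (by simp)
  have hval : ∀ v : (NumberField.RingOfIntegers K)ˣ,
      ∃ n : ℕ, f₁ (v : K) ^ 2 + f₂ (v : K) ^ 2 + f₃ (v : K) ^ 2 = n := by
    intro v
    obtain ⟨n, hn⟩ := exists_int_sum_conjugates hω hgen hr h₁ h₂ h₃
      ((NumberField.RingOfIntegers.isIntegral_coe (v : NumberField.RingOfIntegers K)).pow 2)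
    simp only [map_pow] at hn
    have hn0 : 0 ≤ n := by
      have : (0 : ℝ) ≤ n := by rw [← hn]; positivity
      exact_mod_cast this
    lift n to ℕ using hn0
    exact ⟨n, by simpa using hn⟩
  choose N hN using hval
  have hinv : ∀ (v : (NumberField.RingOfIntegers K)ˣ) (y : K), (v : K) * y = 1 →
      ((v⁻¹ : (NumberField.RingOfIntegers K)ˣ) : K) = y := by
    intro v y hy
    have hv : (v : K) * ((v⁻¹ : (NumberField.RingOfIntegers K)ˣ) : K) = 1 := by
      rw [← map_mul, ← Units.val_mul, mul_inv_cancel, Units.val_one, map_one]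
    exact mul_left_cancel₀ (left_ne_zero_of_mul_eq_one hy) (hv.trans hy.symm)
  have hu₂₃ : ((u₂ * u₃ : (NumberField.RingOfIntegers K)ˣ) : K) = -ω := by
    rw [Units.val_mul, map_mul, hu₂, hu₃]
    linear_combination -hω
  have hu₂' : ((u₂⁻¹ : (NumberField.RingOfIntegers K)ˣ) : K) = 1 - ω - ω ^ 2 :=
    hinv _ _ (by rw [hu₂]; linear_combination ω * hω)
  have hu₃' : ((u₃⁻¹ : (NumberField.RingOfIntegers K)ˣ) : K) = 2 - ω ^ 2 :=
    hinv _ _ (by rw [hu₃]; linear_combination -hω)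
  have hu₂₃' : (((u₂ * u₃)⁻¹ : (NumberField.RingOfIntegers K)ˣ) : K) = 2 - ω - ω ^ 2 :=
    hinv _ _ (by rw [hu₂₃]; linear_combination hω)
  have hreduced : ∀ v, (∀ h ∈ G, N v ≤ N (v * h)) → v ∈ G := by
    intro v hv
    have hstep {h} (hh : h ∈ G) {x y z : ℝ} (hx : f₁ (h : K) ^ 2 = x) (hy : f₂ (h : K) ^ 2 = y)
        (hz : f₃ (h : K) ^ 2 = z) :
        f₁ (v : K) ^ 2 + f₂ (v : K) ^ 2 + f₃ (v : K) ^ 2 ≤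
          f₁ (v : K) ^ 2 * x + f₂ (v : K) ^ 2 * y + f₃ (v : K) ^ 2 * z := by
      have hle : (N v : ℝ) ≤ N (v * h) := by exact_mod_cast hv h hh
      rw [← hN, ← hN] at hle
      simpa only [Units.val_mul, map_mul, mul_pow, hx, hy, hz] using hle
    have hprod := prod_conjugates_sq_eq_one hω hgen hr h₁ h₂ h₃ v
    have hv0 : (v : K) ≠ 0 := by simp
    have hpos (f : K →ₐ[ℚ] ℝ) : 0 < f (v : K) ^ 2 := by
      have := (map_ne_zero f).2 hv0; positivity
    have hp₁ := hpos f₁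
    have hp₂ := hpos f₂
    have hp₃ := hpos f₃
    have hr₂ : (r ^ 2 - 2) ^ 2 = 3 - r - r ^ 2 := by linear_combination (r - 1) * hr
    have hr₃ : (1 - r - r ^ 2) ^ 2 = 2 + r := by linear_combination (r + 1) * hr
    have hlt := add_pow_three_lt_of_le_unit_twists hp₁ hp₂ hp₃ hr hr_lower hr_upper
      (hstep (G.mul_mem hG₂ hG₃)
        (by rw [hu₂₃, map_neg, h₁, neg_sq])
        (by rw [hu₂₃, map_neg, h₂, neg_sq])
        (by rw [hu₂₃, map_neg, h₃, neg_sq]))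
      (hstep (G.inv_mem hG₂)
        (by rw [hu₂', map_sub, map_sub, map_one, map_pow, h₁])
        (by rw [hu₂', map_sub, map_sub, map_one, map_pow, h₂, hr₂]; ring)
        (by rw [hu₂', map_sub, map_sub, map_one, map_pow, h₃, hr₃]; ring))
      (hstep (G.inv_mem hG₃)
        (by rw [hu₃', map_sub, map_ofNat, map_pow, h₁]; ring)
        (by rw [hu₃', map_sub, map_ofNat, map_pow, h₂, hr₂]; ring)
        (by rw [hu₃', map_sub, map_ofNat, map_pow, h₃, hr₃]; ring))
      (hstep (G.inv_mem (G.mul_mem hG₂ hG₃))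
        (by rw [hu₂₃', map_sub, map_sub, map_ofNat, map_pow, h₁])
        (by rw [hu₂₃', map_sub, map_sub, map_ofNat, map_pow, h₂, hr₂]; ring)
        (by rw [hu₂₃', map_sub, map_sub, map_ofNat, map_pow, h₃, hr₃]; ring))
      (hstep hG₂
        (by rw [hu₂, map_add, map_neg, map_pow, map_one, h₁]; ring)
        (by rw [hu₂, map_add, map_neg, map_pow, map_one, h₂, hr₂]; ring)
        (by rw [hu₂, map_add, map_neg, map_pow, map_one, h₃, hr₃]; ring))
      (hstep hG₃
        (by rw [hu₃, map_add, map_one, h₁]; ring)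
        (by rw [hu₃, map_add, map_one, h₂]; ring)
        (by rw [hu₃, map_add, map_one, h₃]; ring))
    rw [hprod, hN] at hlt
    have hamgm : 27 * (f₁ (v : K) ^ 2 * f₂ (v : K) ^ 2 * f₃ (v : K) ^ 2) ≤
        (f₁ (v : K) ^ 2 + f₂ (v : K) ^ 2 + f₃ (v : K) ^ 2) ^ 3 :=
      mul_le_add_pow_three hp₁.le hp₂.le hp₃.le
    rw [hprod, hN] at hamgm
    have hNv : N v = 3 := by
      have hlt' : N v ^ 3 < 4 ^ 3 := by exact_mod_cast (by linarith : (N v : ℝ) ^ 3 < 4 ^ 3)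
      have hge' : 3 ^ 3 ≤ N v ^ 3 := by exact_mod_cast (by linarith : (3 : ℝ) ^ 3 ≤ (N v : ℝ) ^ 3)
      have := lt_of_pow_lt_pow_left₀ 3 (by norm_num) hlt'
      have := le_of_pow_le_pow_left₀ three_ne_zero (by norm_num) hge'
      omega
    have hsq := eq_one_of_sum_eq_three hp₁ hp₂ hp₃ hprod (by rw [hN, hNv]; norm_num)
    rcases sq_eq_one_iff.1 hsq with h | h
    · have hv1 : v = 1 := Units.ext <| NumberField.RingOfIntegers.coe_injective <|
        f₁.injective (by simpa using h)
      exact hv1 ▸ G.one_mem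
    · have hv1 : v = u₁ := Units.ext <| NumberField.RingOfIntegers.coe_injective <|
        f₁.injective (by rw [hu₁]; simpa using h)
      exact hv1 ▸ hG₁
  refine eq_top_iff.2 fun u _ => ?_
  obtain ⟨g, hg, hmin_g⟩ : ∃ g ∈ G, ∀ h ∈ G, N (u * g) ≤ N (u * h) := by
    obtain ⟨g, hg, h⟩ := WellFounded.has_min (measure fun g => N (u * g)).wf
      (G : Set (NumberField.RingOfIntegers K)ˣ) ⟨1, G.one_mem⟩
    exact ⟨g, hg, fun x hx => not_lt.1 (h x hx)⟩
  have h : u * g ∈ G := hreduced _ fun h hh =>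
    mul_assoc u g h ▸ hmin_g _ (G.mul_mem hg hh)
  simpa using G.mul_mem h (G.inv_mem hg)
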